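/- arXiv:1610.06108 — 2 statements merged into one kernel-verified Lean document; each statement's English description precedes it below -/
import Mathlib

section
/- Let S ≥ 1, let γ_1,…,γ_S, β_1,…,β_S be complex numbers with γ_ℓ ≠ β_j for all ℓ, j, and let A_1,…,A_S and B_1,…,B_S be 2 × 2 complex matrices with det A_ℓ = 1 for every ℓ. Then det[ (A_ℓ^{−1} B_j)_{12} / (γ_ℓ − β_j) ]_{ℓ,j=1}^S = (−1)^{S(S−1)/2} · (∏_{ℓ,j=1}^S (γ_ℓ − β_j))^{−1} · det T, where T is the 2S × 2S matrix whose row ℓ (for 1 ≤ ℓ ≤ S) is (γ_ℓ^{m−1} (A_ℓ)_{22})_{m=1}^S followed by (γ_ℓ^{m−1} (A_ℓ)_{12})_{m=1}^S, and whose row S + j (for 1 ≤ j ≤ S) is (β_j^{m−1} (B_j)_{22})_{m=1}^S followed by (β_j^{m−1} (B_j)_{12})_{m=1}^S. -/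
open Matrix Finset Filter Topology

theorem Matrix.det_fromBlocks_diagonal_diagonal {n K : Type*} [Fintype n] [DecidableEq n] [Field K]
    (a b : n → K) (ha : ∀ i, a i ≠ 0) (X Y : Matrix n n K) :
    (fromBlocks (diagonal a) (diagonal b) X Y).det
      = (Y * diagonal a - X * diagonal b).det := by
  have h : fromBlocks (diagonal a) (diagonal b) X Y
        * fromBlocks 1 (-diagonal b) 0 (diagonal a)
      = fromBlocks (diagonal a) 0 X (Y * diagonal a - X * diagonal b) := by
    rw [fromBlocks_multiply]
    congr 1 <;> simp [mul_comm, sub_eq_neg_add, -diagonal_neg]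
  have h' := congrArg det h
  rw [det_mul, det_fromBlocks_zero₂₁, det_fromBlocks_zero₁₂, det_one, one_mul, mul_comm] at h'
  refine mul_left_cancel₀ ?_ h'
  rw [det_diagonal]
  exact prod_ne_zero_iff.2 fun i _ => ha i

theorem Matrix.det_vandermonde_sq {R : Type*} [CommRing R] {n : ℕ} (v : Fin n → R) :
    (vandermonde v).det * (vandermonde v).det
      = (-1) ^ (n * (n - 1) / 2) * ∏ i, ∏ j ∈ univ.erase i, (v j - v i) := by
  have hc : ∑ i : Fin n, #(Ioi i) = n * (n - 1) / 2 := by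
    simp only [Fin.card_Ioi]
    rw [Fin.sum_univ_eq_sum_range (fun i => n - 1 - i), sum_range_reflect (fun i => i),
      sum_range_id]
  have h := prod_prod_Ioi_mul_eq_prod_prod_off_diag fun i j : Fin n => v i - v j
  simp only [compl_singleton, prod_mul_distrib] at h
  have h2 : ∏ i : Fin n, ∏ j ∈ Ioi i, (v i - v j)
      = (-1) ^ (n * (n - 1) / 2) * (vandermonde v).det := by
    rw [det_vandermonde, ← hc, ← prod_pow_eq_pow_sum, ← prod_mul_distrib]
    refine prod_congr rfl fun i _ => ?_
    rw [← prod_const, ← prod_mul_distrib]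
    exact prod_congr rfl fun j _ => by ring
  rw [← det_vandermonde, h2] at h
  have hs : ((-1 : R) ^ (n * (n - 1) / 2)) * (-1) ^ (n * (n - 1) / 2) = 1 := by
    rw [← mul_pow]; simp
  rw [← h]
  linear_combination (-(vandermonde v).det * (vandermonde v).det) * hs

theorem Lagrange.eval_basis_mul_vandermonde {K : Type*} [Field K] {n : ℕ} {v : Fin n → K}
    (hv : Function.Injective v) (w : Fin n → K) :
    (of fun j i => (Lagrange.basis univ v i).eval (w j)) * vandermonde v = vandermonde w := by
  ext j m
  have h := Lagrange.eq_interpolate (s := univ) (v := v) (f := (Polynomial.X : Polynomial K) ^ (m : ℕ))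
    hv.injOn (by simp)
  have h' := congrArg (Polynomial.eval (w j)) h
  simp only [Lagrange.interpolate_apply, Polynomial.eval_finsetSum, Polynomial.eval_mul,
    Polynomial.eval_C, Polynomial.eval_pow, Polynomial.eval_X] at h'
  simp only [mul_apply, of_apply, vandermonde_apply, h']
  exact sum_congr rfl fun i _ => mul_comm _ _

theorem Lagrange.eval_basis_eq_prod_div {K : Type*} [Field K] {n : ℕ} (v : Fin n → K) (i : Fin n)
    {x : K} (hx : v i ≠ x) :
    (Lagrange.basis univ v i).eval x
      = (∏ k, (v k - x)) * ((∏ k ∈ univ.erase i, (v k - v i))⁻¹ * (v i - x)⁻¹) := by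
  rw [← mul_prod_erase univ _ (mem_univ i), Lagrange.basis, Polynomial.eval_prod]
  have : v i - x ≠ 0 := sub_ne_zero.2 hx
  field_simp
  rw [← prod_div_distrib]
  refine prod_congr rfl fun k _ => ?_
  rw [Lagrange.basisDivisor, Polynomial.eval_mul, Polynomial.eval_C, Polynomial.eval_sub,
    Polynomial.eval_X, Polynomial.eval_C, ← neg_sub x, ← neg_sub (v i) (v k), neg_div_neg_eq,
    div_eq_inv_mul]

/-- The block Vandermonde matrix with rows
`(x ^ m * a)ₘ` followed by `(x ^ m * b)ₘ`. -/
def Matrix.blockVandermonde {R : Type*} [CommRing R] {n : ℕ} (x y a b c d : Fin n → R) :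
    Matrix (Fin n ⊕ Fin n) (Fin n ⊕ Fin n) R :=
  fromBlocks (diagonal a * vandermonde x) (diagonal b * vandermonde x)
    (diagonal c * vandermonde y) (diagonal d * vandermonde y)

theorem Matrix.det_cauchy_eq_of_injective {K : Type*} [Field K] {n : ℕ}
    {x y a b c d : Fin n → K} (hx : Function.Injective x) (ha : ∀ i, a i ≠ 0)
    (hxy : ∀ i j, x i ≠ y j) :
    (of fun i j => (a i * d j - b i * c j) / (x i - y j)).det
      = (-1) ^ (n * (n - 1) / 2) * (∏ i, ∏ j, (x i - y j))⁻¹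
        * (blockVandermonde x y a b c d).det := by
  set M : Matrix (Fin n) (Fin n) K := of fun j i => (Lagrange.basis univ x i).eval (y j) with hM
  have hMV : M * vandermonde x = vandermonde y := Lagrange.eval_basis_mul_vandermonde hx y
  have hT : blockVandermonde x y a b c d
      = fromBlocks (diagonal a) (diagonal b) (diagonal c * M) (diagonal d * M)
        * fromBlocks (vandermonde x) 0 0 (vandermonde x) := by
    rw [fromBlocks_multiply, blockVandermonde]
    simp [Matrix.mul_assoc, hMV]
  have hK : diagonal d * M * diagonal a - diagonal c * M * diagonal b
      = of fun j i => (∏ k, (x k - y j)) * ((of fun j i => (∏ k ∈ univ.erase i, (x k - x i))⁻¹ *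
        (of fun i j => (a i * d j - b i * c j) / (x i - y j))ᵀ j i : Matrix _ _ K) j i) := by
    ext j i
    simp only [sub_apply, mul_diagonal, diagonal_mul, hM, of_apply, transpose_apply,
      Lagrange.eval_basis_eq_prod_div x i (hxy i j)]
    ring
  have h1 : ∏ i, ∏ j, (x i - y j) ≠ 0 :=
    prod_ne_zero_iff.2 fun i _ => prod_ne_zero_iff.2 fun j _ => sub_ne_zero.2 (hxy i j)
  have h2 : ∏ i, ∏ k ∈ univ.erase i, (x k - x i) ≠ 0 :=
    prod_ne_zero_iff.2 fun i _ => prod_ne_zero_iff.2 fun j hj =>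
      sub_ne_zero.2 (hx.ne (ne_of_mem_erase hj))
  have hs : ((-1 : K) ^ (n * (n - 1) / 2)) * (-1) ^ (n * (n - 1) / 2) = 1 := by
    rw [← mul_pow]; simp
  rw [hT, det_mul, det_fromBlocks_diagonal_diagonal _ _ ha, hK, det_mul_column, det_mul_row,
    det_transpose, det_fromBlocks_zero₂₁, det_vandermonde_sq, prod_inv_distrib,
    prod_comm (f := fun j k => x k - y j)]
  field_simp
  linear_combination (-(of fun i j => (a i * d j - b i * c j) / (x i - y j)).det) * hs

theorem Matrix.det_cauchy_eq {n : ℕ} {x y : Fin n → ℂ} (a b c d : Fin n → ℂ)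
    (hxy : ∀ i j, x i ≠ y j) :
    (of fun i j => (a i * d j - b i * c j) / (x i - y j)).det
      = (-1) ^ (n * (n - 1) / 2) * (∏ i, ∏ j, (x i - y j))⁻¹
        * (blockVandermonde x y a b c d).det := by
  set X : ℂ → Fin n → ℂ := fun t i => x i + t * (i : ℕ) with hX
  set A : ℂ → Fin n → ℂ := fun t i => a i + t with hA
  have hX0 : X 0 = x := by ext; simp [hX]
  have hA0 : A 0 = a := by ext; simp [hA]
  have hXc : Continuous X := by fun_prop
  have hAc : Continuous A := by fun_prop
  have hXi : ∀ i, Continuous fun t => X t i := fun i => by fun_prop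
  have hAi : ∀ i, Continuous fun t => A t i := fun i => by fun_prop
  have ev_ne (p q : ℂ) (hq : p ≠ 0 ∨ q ≠ 0) : ∀ᶠ t in 𝓝[≠] (0 : ℂ), p + t * q ≠ 0 := by
    by_cases hp : p = 0
    · filter_upwards [self_mem_nhdsWithin] with t ht
      simpa [hp] using ⟨ht, hq.resolve_left (not_not.2 hp)⟩
    · refine Filter.Eventually.filter_mono nhdsWithin_le_nhds ?_
      have : ContinuousAt (fun t : ℂ => p + t * q) 0 := by fun_prop
      exact this.eventually_ne (by simpa using hp)
  have e1 : ∀ᶠ t in 𝓝[≠] (0 : ℂ), Function.Injective (X t) := by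
    have : ∀ᶠ t in 𝓝[≠] (0 : ℂ), ∀ i j : Fin n, i ≠ j →
        (x i - x j) + t * ((i : ℕ) - (j : ℕ) : ℂ) ≠ 0 := by
      simp only [eventually_all]
      intro i j hij
      exact ev_ne _ _ (Or.inr (sub_ne_zero.2 (by exact_mod_cast Fin.val_ne_of_ne hij)))
    filter_upwards [this] with t ht i j hij
    by_contra hne
    exact ht i j hne (by simp only [hX] at hij; linear_combination hij)
  have e2 : ∀ᶠ t in 𝓝[≠] (0 : ℂ), ∀ i, A t i ≠ 0 := by
    simp only [eventually_all]
    intro i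
    simpa [hA] using ev_ne (a i) 1 (Or.inr one_ne_zero)
  have e3 : ∀ᶠ t in 𝓝[≠] (0 : ℂ), ∀ i j, X t i ≠ y j := by
    simp only [eventually_all]
    intro i j
    filter_upwards [ev_ne (x i - y j) (i : ℕ) (Or.inl (sub_ne_zero.2 (hxy i j)))] with t ht h
    exact ht (by simp only [hX] at h; linear_combination h)
  have hd : ∀ i j, X 0 i - y j ≠ 0 := fun i j => by rw [hX0]; exact sub_ne_zero.2 (hxy i j)
  have c1 : ContinuousAt
      (fun t => (of fun i j => (A t i * d j - b i * c j) / (X t i - y j)).det) 0 := by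
    simp only [det_apply, of_apply]
    refine tendsto_finsetSum _ fun σ _ => Tendsto.const_smul (tendsto_finsetProd _ fun i _ => ?_) _
    exact ContinuousAt.div (by fun_prop) (by fun_prop) (hd _ _)
  have c2 : ContinuousAt (fun t => (-1) ^ (n * (n - 1) / 2) * (∏ i, ∏ j, (X t i - y j))⁻¹
        * (blockVandermonde (X t) y (A t) b c d).det) 0 := by
    have c3 : Continuous fun t => (blockVandermonde (X t) y (A t) b c d).det := by
      refine Continuous.matrix_det (Continuous.matrix_fromBlocks ?_ ?_ ?_ ?_) <;>
        refine continuous_matrix fun i j => ?_ <;>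
        simp only [diagonal_mul, vandermonde_apply] <;> fun_prop
    refine ContinuousAt.mul (ContinuousAt.mul continuousAt_const (ContinuousAt.inv₀ ?_ ?_))
      c3.continuousAt
    · fun_prop
    · exact prod_ne_zero_iff.2 fun i _ => prod_ne_zero_iff.2 fun j _ => hd i j
  have heq := tendsto_nhds_unique_of_eventuallyEq
    (c1.tendsto.mono_left (nhdsWithin_le_nhds (s := {0}ᶜ)))
    (c2.tendsto.mono_left nhdsWithin_le_nhds) (by
      filter_upwards [e1, e2, e3] with t h1 h2 h3
      exact det_cauchy_eq_of_injective h1 h2 h3)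
  simpa only [hX0, hA0] using heq

/-- specialization of the determinantal lemma to (1,2) entries of
products `Aₗ⁻¹ * Bⱼ` of 2×2 matrices of determinant one (equation (3.4) of the paper). -/
theorem stmt_2 (S : ℕ) (hS : 1 ≤ S) (γ β : Fin S → ℂ)
    (hd : ∀ ℓ j, γ ℓ ≠ β j)
    (A B : Fin S → Matrix (Fin 2) (Fin 2) ℂ)
    (hA : ∀ ℓ, (A ℓ).det = 1) :
    Matrix.det (Matrix.of fun ℓ j : Fin S => ((A ℓ)⁻¹ * B j) 0 1 / (γ ℓ - β j))
      = (-1 : ℂ) ^ (S * (S - 1) / 2) * (∏ ℓ, ∏ j, (γ ℓ - β j))⁻¹ *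
        Matrix.det (Matrix.of fun p q : Fin S ⊕ Fin S =>
          match p, q with
          | Sum.inl ℓ, Sum.inl m => γ ℓ ^ (m : ℕ) * A ℓ 1 1
          | Sum.inl ℓ, Sum.inr m => γ ℓ ^ (m : ℕ) * A ℓ 0 1
          | Sum.inr j, Sum.inl m => β j ^ (m : ℕ) * B j 1 1
          | Sum.inr j, Sum.inr m => β j ^ (m : ℕ) * B j 0 1) := by
  have hL : (Matrix.of fun ℓ j : Fin S => ((A ℓ)⁻¹ * B j) 0 1 / (γ ℓ - β j))
      = of fun ℓ j => (A ℓ 1 1 * B j 0 1 - A ℓ 0 1 * B j 1 1) / (γ ℓ - β j) := by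
    ext ℓ j
    simp [Matrix.inv_def, hA ℓ, adjugate_fin_two, mul_apply, Fin.sum_univ_two, sub_eq_add_neg]
  rw [hL, det_cauchy_eq (fun ℓ => A ℓ 1 1) (fun ℓ => A ℓ 0 1) (fun j => B j 1 1)
    (fun j => B j 0 1) hd]
  congr 2
  ext (ℓ | j) (m | m) <;> simp [blockVandermonde, diagonal_mul, mul_comm]
end

section
/- Let w, (p_k), (h_k), the averages ⟨·⟩_n and the Christoffel–Darboux kernel K_m be as in the context. Let n ≥ 1, S ≥ 1, let b_1,…,b_S be pairwise distinct complex numbers and c_1,…,c_S be pairwise distinct complex numbers. Then ⟨ ∏_{j=1}^S ∏_{i=1}^n (b_j − x_i)(c_j − x_i) ⟩_n = ( ∏_{ℓ=n}^{n+S−1} h_ℓ ) · det[ K_{n+S}(c_ℓ, b_j) ]_{ℓ,j=1}^S / ( Δ(c) Δ(b) ), where Δ(b) := ∏_{1≤j<k≤S}(b_j − b_k) and Δ(c) := ∏_{1≤j<k≤S}(c_j − c_k). -/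
open Finset MeasureTheory

/-- The Vandermonde-type product `Δ(v) = ∏_{j<k} (v_j - v_k)` (complex points). -/
noncomputable def vdmC {m : ℕ} (v : Fin m → ℂ) : ℂ :=
  ∏ p ∈ Finset.univ.filter (fun p : Fin m × Fin m => p.1 < p.2), (v p.1 - v p.2)

/-- The Vandermonde-type product `Δ(x) = ∏_{i<j} (x_i - x_j)` (real points). -/
noncomputable def vdmR {m : ℕ} (v : Fin m → ℝ) : ℝ :=
  ∏ p ∈ Finset.univ.filter (fun p : Fin m × Fin m => p.1 < p.2), (v p.1 - v p.2)

theorem vdmC_eq {m : ℕ} (v : Fin m → ℂ) :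
    vdmC v = ∏ i, ∏ j, if i < j then v i - v j else 1 := by
  rw [vdmC, Finset.prod_filter, Fintype.prod_prod_type]

theorem vdmC_ofReal {m : ℕ} (v : Fin m → ℝ) : vdmC (fun i => (v i : ℂ)) = vdmR v := by
  simp [vdmC, vdmR]

theorem vdmC_ne_zero {m : ℕ} {v : Fin m → ℂ} (hv : Function.Injective v) : vdmC v ≠ 0 := by
  refine Finset.prod_ne_zero_iff.2 fun p hp => sub_ne_zero.2 fun e => ?_
  exact (Finset.mem_filter.1 hp).2.ne (hv e)

theorem vdmC_append {S n : ℕ} (b : Fin S → ℂ) (x : Fin n → ℂ) :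
    vdmC (Fin.append b x) = vdmC b * vdmC x * ∏ j, ∏ i, (b j - x i) := by
  have h1 (i : Fin S) (j : Fin n) : Fin.castAdd n i < Fin.natAdd S j :=
    Fin.lt_def.2 (i.2.trans_le (Nat.le_add_right _ _))
  have h2 (i : Fin S) (j : Fin n) : ¬ Fin.natAdd S j < Fin.castAdd n i := (h1 i j).not_gt
  have h3 (i j : Fin S) : Fin.castAdd n i < Fin.castAdd n j ↔ i < j := Iff.rfl
  simp only [vdmC_eq, Fin.prod_univ_add, Fin.append_left, Fin.append_right, h1, h2, if_true,
    if_false, Finset.prod_mul_distrib, Finset.prod_const_one,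
    h3, Fin.natAdd_lt_natAdd_iff]
  ring

theorem vdmC_eq_sign_mul_det {m : ℕ} (v : Fin m → ℂ) :
    vdmC v = (-1) ^ #{p : Fin m × Fin m | p.1 < p.2} * (Matrix.vandermonde v).det := by
  have : (Matrix.vandermonde v).det =
      ∏ p ∈ Finset.univ.filter (fun p : Fin m × Fin m => p.1 < p.2), (v p.2 - v p.1) := by
    rw [Matrix.det_vandermonde, Finset.prod_filter, Fintype.prod_prod_type]
    refine Finset.prod_congr rfl fun i _ => ?_
    rw [← Finset.prod_filter]
    exact Finset.prod_congr (by ext; simp) fun _ _ => rfl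
  rw [this, vdmC, ← Finset.prod_const, ← Finset.prod_mul_distrib]
  exact Finset.prod_congr rfl fun p _ => by ring

theorem vdmC_mul_vdmC {m : ℕ} (v v' : Fin m → ℂ) :
    vdmC v * vdmC v' = (Matrix.vandermonde v).det * (Matrix.vandermonde v').det := by
  rw [vdmC_eq_sign_mul_det, vdmC_eq_sign_mul_det, mul_mul_mul_comm, ← mul_pow]
  simp

theorem det_vandermonde_append {S n : ℕ} (p : ℕ → Polynomial ℝ) (hp_monic : ∀ k, (p k).Monic)
    (hp_deg : ∀ k, (p k).natDegree = k) (b : Fin S → ℂ) (x : Fin n → ℂ) :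
    (Matrix.vandermonde (Fin.append b x)).det =
      (Matrix.of fun r k : Fin S ⊕ Fin n =>
        Polynomial.aeval (Sum.elim b x r) (p (finSumFinEquiv k))).det := by
  rw [Matrix.det_eval_matrixOfPolynomials_eq_det_vandermonde (Fin.append b x)
    (fun k => (p k).map (algebraMap ℝ ℂ)) (fun k => by simp [hp_deg])
    (fun k => (hp_monic k).map _), ← Matrix.det_submatrix_equiv_self finSumFinEquiv]
  congr 1
  ext r k
  rcases r with r | r <;> simp [Polynomial.aeval_def, Polynomial.eval_map]

theorem Equiv.Perm.sum_eq_on_inr {A B M : Type*} [Fintype A] [Fintype B] [DecidableEq A]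
    [DecidableEq B] [AddCommMonoid M] (σ : Equiv.Perm (A ⊕ B)) (f : Equiv.Perm (A ⊕ B) → M) :
    (∑ τ, if ∀ i, σ (.inr i) = τ (.inr i) then f τ else 0) =
      ∑ ρ : Equiv.Perm A, f (σ * Equiv.Perm.sumCongr ρ 1) := by
  rw [← Finset.sum_filter]
  symm
  refine Finset.sum_bij (fun ρ _ => σ * Equiv.Perm.sumCongr ρ 1) ?_ ?_ ?_ (fun _ _ => rfl)
  · intro ρ _; simp
  · intro ρ _ ρ' _ e
    ext a
    have := congrArg (fun τ : Equiv.Perm (A ⊕ B) => τ (.inl a)) e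
    simpa using this
  · intro τ hτ
    have hτ : ∀ i, σ (.inr i) = τ (.inr i) := by simpa using hτ
    obtain ⟨⟨ρ, ρ'⟩, e⟩ : σ⁻¹ * τ ∈ (Equiv.Perm.sumCongrHom A B).range := by
      refine Equiv.Perm.mem_sumCongrHom_range_of_perm_mapsTo_inl ?_
      rintro _ ⟨a, rfl⟩
      rcases hs : (σ⁻¹ * τ) (.inl a) with a' | i
      · exact ⟨a', rfl⟩
      · have : τ (.inl a) = σ (.inr i) := by rw [← hs]; simp
        rw [hτ] at this
        simp at this
    have hρ' : ρ' = 1 := by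
      ext i
      have := congrArg (fun τ : Equiv.Perm (A ⊕ B) => τ (.inr i)) e
      simpa [← hτ] using this
    subst hρ'
    exact ⟨ρ, by simp, by
      rw [show Equiv.Perm.sumCongr ρ 1 = σ⁻¹ * τ from e, mul_inv_cancel_left]⟩

theorem Equiv.Perm.card_comp_inl_eq {A B : Type*} [Fintype A] [Fintype B] [DecidableEq A]
    [DecidableEq B] {f : A → A ⊕ B} (hf : Function.Injective f) :
    #{τ : Equiv.Perm (A ⊕ B) | τ ∘ Sum.inl = f} = (Fintype.card B).factorial := by
  classical
  obtain ⟨σ, hσ⟩ : ∃ σ : Equiv.Perm (A ⊕ B), ∀ a, σ (.inl a) = f a := by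
    let e : {x // x ∈ Set.range (Sum.inl : A → A ⊕ B)} ≃ {x // x ∈ Set.range f} :=
      (Equiv.ofInjective _ Sum.inl_injective).symm.trans (Equiv.ofInjective f hf)
    refine ⟨e.extendSubtype, fun a => ?_⟩
    rw [e.extendSubtype_apply_of_mem _ ⟨a, rfl⟩]
    have : (Equiv.ofInjective (Sum.inl : A → A ⊕ B) Sum.inl_injective).symm ⟨.inl a, a, rfl⟩ = a :=
      Equiv.ofInjective_symm_apply Sum.inl_injective a
    simp [e, this]
  have key := Equiv.Perm.sum_eq_on_inr ((Equiv.sumComm A B).permCongr σ) (fun _ => 1)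
  rw [Finset.sum_const, smul_eq_mul, mul_one, Finset.card_univ, Fintype.card_perm] at key
  rw [← key, Finset.card_filter]
  refine Fintype.sum_equiv (Equiv.sumComm A B).permCongr _ _ fun τ => ?_
  congr 1
  simp [funext_iff, hσ, Equiv.permCongr_apply, eq_comm, Sum.swap_leftInverse.injective.eq_iff]

theorem Equiv.Perm.sum_comp_inl {A B R : Type*} [Fintype A] [Fintype B] [DecidableEq A]
    [DecidableEq B] [CommRing R] (G : (A → A ⊕ B) → R)
    (hG : ∀ f, ¬ Function.Injective f → G f = 0) :
    ∑ σ : Equiv.Perm (A ⊕ B), G (σ ∘ Sum.inl) = (Fintype.card B).factorial * ∑ f, G f := by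
  rw [← Finset.sum_fiberwise (s := Finset.univ)
    (g := fun σ : Equiv.Perm (A ⊕ B) => (σ ∘ Sum.inl : A → A ⊕ B)), Finset.mul_sum]
  refine Finset.sum_congr rfl fun f _ => ?_
  rw [Finset.sum_congr rfl fun σ hσ => congrArg G (Finset.mem_filter.1 hσ).2, Finset.sum_const,
    nsmul_eq_mul]
  by_cases hf : Function.Injective f
  · rw [Equiv.Perm.card_comp_inl_eq hf]
  · simp [hG f hf]

theorem Matrix.det_sum_mul {A ι R : Type*} [Fintype A] [DecidableEq A] [Fintype ι]
    [DecidableEq ι] [CommRing R] (u v : A → ι → R) :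
    (Matrix.of fun l j : A => ∑ k, v l k * u j k).det =
      ∑ f : A → ι, (∏ a, u a (f a)) * (Matrix.of fun l j : A => v l (f j)).det := by
  simp only [Matrix.det_apply', Matrix.of_apply, Finset.prod_univ_sum, Fintype.piFinset_univ,
    Finset.mul_sum]
  rw [Finset.sum_comm]
  refine Finset.sum_congr rfl fun f _ => Finset.sum_congr rfl fun ρ _ => ?_
  rw [Finset.prod_mul_distrib]
  ring

theorem sum_perm_sum_perm_eq_det {A B K : Type*} [Fintype A] [Fintype B] [DecidableEq A]
    [DecidableEq B] [Field K] (u v : A → A ⊕ B → K) (h : A ⊕ B → K) (hh : ∀ k, h k ≠ 0) :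
    (∑ σ : Equiv.Perm (A ⊕ B), ∑ τ : Equiv.Perm (A ⊕ B),
      ((Equiv.Perm.sign σ : ℤ) : K) * ((Equiv.Perm.sign τ : ℤ) : K) *
        ((∏ a, u a (σ (.inl a))) * (∏ a, v a (τ (.inl a))) *
          ∏ i, if σ (.inr i) = τ (.inr i) then h (σ (.inr i)) else 0)) =
      (Fintype.card B).factorial * (∏ k, h k) *
        (Matrix.of fun l j : A => ∑ k, v l k * u j k / h k).det := by
  let G : (A → A ⊕ B) → K := fun f =>
    (∏ a, u a (f a) / h (f a)) * (Matrix.of fun l j : A => v l (f j)).det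
  have hG (f) (hf : ¬ Function.Injective f) : G f = 0 := by
    obtain ⟨i, j, hij, hne⟩ : ∃ i j, f i = f j ∧ i ≠ j := by
      simpa [Function.Injective] using hf
    simp only [G]
    rw [Matrix.det_zero_of_column_eq hne (by simp [hij]), mul_zero]
  simp only [mul_div_assoc]
  rw [Matrix.det_sum_mul (fun j k => u j k / h k), mul_right_comm,
    ← Equiv.Perm.sum_comp_inl G hG, Finset.sum_mul]
  refine Finset.sum_congr rfl fun σ _ => ?_
  have h1 : ∏ k, h k = (∏ a, h (σ (.inl a))) * ∏ i, h (σ (.inr i)) := by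
    rw [← Equiv.prod_comp σ, Fintype.prod_sum_type]
  have h2 : ∏ a, h (σ (.inl a)) ≠ 0 := Finset.prod_ne_zero_iff.2 fun a _ => hh _
  simp only [Fintype.prod_ite_zero, mul_ite, mul_zero]
  simp only [G]
  rw [Equiv.Perm.sum_eq_on_inr σ, ← Matrix.det_transpose, Matrix.det_apply', h1]
  simp only [Function.comp_apply, Finset.prod_div_distrib, Finset.mul_sum, Finset.sum_mul]
  refine Finset.sum_congr rfl fun ρ _ => ?_
  have h3 : ((Equiv.Perm.sign σ : ℤ) : K) * ((Equiv.Perm.sign σ : ℤ) : K) = 1 := by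
    rcases Int.units_eq_one_or (Equiv.Perm.sign σ) with e | e <;> simp [e]
  simp only [Equiv.Perm.sign_mul, Equiv.Perm.sign_sumCongr, Equiv.Perm.sign_one, mul_one,
    Units.val_mul, Int.cast_mul, Equiv.Perm.coe_mul, Function.comp_apply,
    Equiv.Perm.sumCongr_apply, Sum.map_inl, Matrix.transpose_apply, Matrix.of_apply]
  field_simp
  linear_combination (((Equiv.Perm.sign ρ : ℤ) : K)) * (∏ a, u a (σ (.inl a))) *
    (∏ a, v a (σ (.inl (ρ a)))) * (∏ i, h (σ (.inr i))) * h3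

/-- A generalized Andréief identity for functions orthogonal with respect to `w`: the determinants
carry `A` rows of constants in addition to the `B` rows evaluated at integration variables. -/
theorem integral_det_mul_det {A B : Type*} [Fintype A] [Fintype B] [DecidableEq A]
    [DecidableEq B] (u v : A → A ⊕ B → ℂ) (q : A ⊕ B → ℝ → ℂ) (w : ℝ → ℂ) (h : A ⊕ B → ℂ)
    (hh : ∀ k, h k ≠ 0) (hint : ∀ j k, Integrable fun x => q j x * q k x * w x)
    (horth : ∀ j k, ∫ x, q j x * q k x * w x = if j = k then h j else 0) :
    ∫ x : B → ℝ, (Matrix.of (Sum.elim u fun i k => q k (x i))).det *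
        (Matrix.of (Sum.elim v fun i k => q k (x i))).det * ∏ i, w (x i) =
      (Fintype.card B).factorial * (∏ k, h k) *
        (Matrix.of fun l j : A => ∑ k, v l k * u j k / h k).det := by
  let F : Equiv.Perm (A ⊕ B) → Equiv.Perm (A ⊕ B) → (B → ℝ) → ℂ := fun σ τ x =>
    ((Equiv.Perm.sign σ : ℤ) : ℂ) * ((Equiv.Perm.sign τ : ℤ) : ℂ) *
      ((∏ a, u a (σ (.inl a))) * (∏ a, v a (τ (.inl a))) *
        ∏ i, (q (σ (.inr i)) (x i) * q (τ (.inr i)) (x i) * w (x i)))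
  have hF (x : B → ℝ) : (Matrix.of (Sum.elim u fun i k => q k (x i))).det *
      (Matrix.of (Sum.elim v fun i k => q k (x i))).det * ∏ i, w (x i) =
      ∑ σ, ∑ τ, F σ τ x := by
    rw [← Matrix.det_transpose, Matrix.det_apply', ← Matrix.det_transpose, Matrix.det_apply',
      Finset.sum_mul_sum, Finset.sum_mul]
    refine Finset.sum_congr rfl fun σ _ => ?_
    rw [Finset.sum_mul]
    refine Finset.sum_congr rfl fun τ _ => ?_
    simp only [F, Fintype.prod_sum_type, Matrix.transpose_apply, Matrix.of_apply, Sum.elim_inl,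
      Sum.elim_inr, Finset.prod_mul_distrib]
    ring
  have hFint (σ τ) : Integrable (F σ τ) :=
    ((Integrable.fintype_prod (fun i => hint (σ (.inr i)) (τ (.inr i)))).const_mul _).const_mul _
  simp_rw [hF]
  rw [integral_finsetSum _ fun σ _ => integrable_finsetSum _ fun τ _ => hFint σ τ,
    ← sum_perm_sum_perm_eq_det u v h hh]
  refine Finset.sum_congr rfl fun σ _ => ?_
  rw [integral_finsetSum _ fun τ _ => hFint σ τ]
  refine Finset.sum_congr rfl fun τ _ => ?_
  simp only [F]
  rw [integral_const_mul, integral_const_mul, integral_fintype_prod_volume_eq_prod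
    (f := fun i x => q (σ (.inr i)) x * q (τ (.inr i)) x * w x)]
  simp only [horth]

theorem integrable_polynomial_mul {w : ℝ → ℝ} (hw_meas : Measurable w)
    (hw_moments : ∀ k : ℕ, Integrable (fun x : ℝ => |x| ^ k * w x)) (P : Polynomial ℝ) :
    Integrable fun x => P.eval x * w x := by
  simp only [Polynomial.eval_eq_sum_range, Finset.sum_mul, mul_assoc]
  refine integrable_finsetSum _ fun k _ => Integrable.const_mul ?_ _
  refine (hw_moments k).mono (by fun_prop) (.of_forall fun x => ?_)
  simp

theorem integral_prod_eval_mul_vdmR_sq {w : ℝ → ℝ} (hw_meas : Measurable w)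
    (hw_moments : ∀ k : ℕ, Integrable (fun x : ℝ => |x| ^ k * w x))
    {p : ℕ → Polynomial ℝ} (hp_monic : ∀ k, (p k).Monic) (hp_deg : ∀ k, (p k).natDegree = k)
    (hp_orth : ∀ j k, j ≠ k → ∫ x : ℝ, (p j).eval x * (p k).eval x * w x = 0)
    {h : ℕ → ℝ} (hh : ∀ k, h k = ∫ x : ℝ, ((p k).eval x) ^ 2 * w x) (hh_pos : ∀ k, 0 < h k)
    (n S : ℕ) (b c : Fin S → ℂ) :
    vdmC c * vdmC b * ∫ x : Fin n → ℝ,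
        (∏ j : Fin S, ∏ i : Fin n, ((b j - (x i : ℂ)) * (c j - (x i : ℂ)))) *
        (((vdmR x) ^ 2 * ∏ i, w (x i) : ℝ) : ℂ) =
      n.factorial * ((∏ k ∈ Finset.range (n + S), h k : ℝ) : ℂ) *
        Matrix.det (Matrix.of fun ℓ j : Fin S =>
          ∑ k ∈ Finset.range (n + S),
            (Polynomial.aeval (c ℓ)) (p k) * (Polynomial.aeval (b j)) (p k) /
              (h k : ℂ)) := by
  have hfin {M : Type} [CommMonoid M] (g : ℕ → M) :
      ∏ k : Fin S ⊕ Fin n, g (finSumFinEquiv k) = ∏ k ∈ Finset.range (n + S), g k := by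
    rw [add_comm n S, ← Fin.prod_univ_eq_prod_range,
      Equiv.prod_comp finSumFinEquiv (fun k : Fin (S + n) => g k)]
  have hfin' (g : ℕ → ℂ) :
      ∑ k : Fin S ⊕ Fin n, g (finSumFinEquiv k) = ∑ k ∈ Finset.range (n + S), g k :=
    hfin (M := Multiplicative ℂ) g
  have key := integral_det_mul_det
    (fun j (k : Fin S ⊕ Fin n) => Polynomial.aeval (b j) (p (finSumFinEquiv k)))
    (fun j (k : Fin S ⊕ Fin n) => Polynomial.aeval (c j) (p (finSumFinEquiv k)))
    (fun k x => (((p (finSumFinEquiv k)).eval x : ℝ) : ℂ)) (fun x => (w x : ℂ))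
    (fun k => (h (finSumFinEquiv k) : ℂ))
    (fun k => by exact_mod_cast (hh_pos _).ne')
    (fun j k => by
      have := (integrable_polynomial_mul hw_meas hw_moments
        (p (finSumFinEquiv j) * p (finSumFinEquiv k))).ofReal (𝕜 := ℂ)
      simpa using this)
    (fun j k => by
      simp only [← Complex.ofReal_mul]
      rw [integral_complex_ofReal]
      split_ifs with hjk
      · subst hjk
        simp [hh, sq]
      · rw [hp_orth, Complex.ofReal_zero]
        exact fun e => hjk (finSumFinEquiv.injective (Fin.ext e)))
  have hsum (l j : Fin S) := hfin' fun k =>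
    Polynomial.aeval (c l) (p k) * Polynomial.aeval (b j) (p k) / (h k : ℂ)
  simp only [hsum, hfin fun k => (h k : ℂ), Fintype.card_fin] at key
  rw [Complex.ofReal_prod, ← key, ← integral_const_mul]
  refine integral_congr_ae (.of_forall fun x => ?_)
  have hdet (b : Fin S → ℂ) : (Matrix.of (Sum.elim
      (fun j (k : Fin S ⊕ Fin n) => Polynomial.aeval (b j) (p (finSumFinEquiv k)))
      (fun i k => (((p (finSumFinEquiv k)).eval (x i) : ℝ) : ℂ)))).det =
      (Matrix.vandermonde (Fin.append b fun i => (x i : ℂ))).det := by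
    rw [det_vandermonde_append p hp_monic hp_deg]
    congr 1
    ext r k
    rcases r with r | r
    · simp
    · simpa using (Polynomial.aeval_algebraMap_apply_eq_algebraMap_eval (A := ℂ) (x r) _).symm
  simp only [hdet]
  rw [← vdmC_mul_vdmC, vdmC_append, vdmC_append, vdmC_ofReal]
  push_cast
  simp only [Finset.prod_mul_distrib]
  ring

/-- case [I] of Proposition 2.2 of the paper — averages of products of
characteristic polynomials in terms of the Christoffel–Darboux kernel. -/
theorem stmt_13 (w : ℝ → ℝ) (hw_meas : Measurable w) (hw_nonneg : ∀ x, 0 ≤ w x)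
    (hw_moments : ∀ k : ℕ, Integrable (fun x : ℝ => |x| ^ k * w x))
    (hw_pos : 0 < ∫ x : ℝ, w x)
    (p : ℕ → Polynomial ℝ) (hp_monic : ∀ k, (p k).Monic)
    (hp_deg : ∀ k, (p k).natDegree = k)
    (hp_orth : ∀ j k, j ≠ k → ∫ x : ℝ, (p j).eval x * (p k).eval x * w x = 0)
    (h : ℕ → ℝ) (hh : ∀ k, h k = ∫ x : ℝ, ((p k).eval x) ^ 2 * w x)
    (hh_pos : ∀ k, 0 < h k)
    (n S : ℕ) (hn : 1 ≤ n) (hS : 1 ≤ S)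
    (b c : Fin S → ℂ) (hb : Function.Injective b) (hc : Function.Injective c)
    (Z : ℝ) (hZ : Z = ∫ x : Fin n → ℝ, (vdmR x) ^ 2 * ∏ i, w (x i))
    (hZ_int : Integrable (fun x : Fin n → ℝ => (vdmR x) ^ 2 * ∏ i, w (x i)))
    (hZ_pos : 0 < Z) :
    (Z : ℂ)⁻¹ * ∫ x : Fin n → ℝ,
        (∏ j : Fin S, ∏ i : Fin n, ((b j - (x i : ℂ)) * (c j - (x i : ℂ)))) *
        (((vdmR x) ^ 2 * ∏ i, w (x i) : ℝ) : ℂ)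
      = ((∏ ℓ ∈ Finset.Ico n (n + S), h ℓ : ℝ) : ℂ) *
        Matrix.det (Matrix.of fun ℓ j : Fin S =>
          ∑ k ∈ Finset.range (n + S),
            (Polynomial.aeval (c ℓ)) (p k) * (Polynomial.aeval (b j)) (p k) /
              (h k : ℂ)) /
        (vdmC c * vdmC b) := by
  have key := integral_prod_eval_mul_vdmR_sq hw_meas hw_moments hp_monic hp_deg hp_orth hh hh_pos
  have hZ' : (Z : ℂ) = n.factorial * ((∏ k ∈ Finset.range n, h k : ℝ) : ℂ) := by
    have := key n 0 Fin.elim0 Fin.elim0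
    simp only [vdmC, Finset.univ_eq_empty, Finset.filter_empty, Finset.prod_empty, one_mul,
      Matrix.det_fin_zero, mul_one, add_zero] at this
    rw [← this, hZ, integral_complex_ofReal]
  have hZ0 : (Z : ℂ) ≠ 0 := by exact_mod_cast hZ_pos.ne'
  rw [eq_div_iff (mul_ne_zero (vdmC_ne_zero hc) (vdmC_ne_zero hb)), mul_assoc,
    mul_comm _ (vdmC c * vdmC b), key n S b c, inv_mul_eq_iff_eq_mul₀ hZ0, hZ',
    ← Finset.prod_range_mul_prod_Ico h (Nat.le_add_right n S)]
  push_cast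
  ring
end
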